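/- For any positive integers n and a, with b = gcd(n, a), the polynomial ∑_{d∣n} μ(d) · ∏_{j=1}^{n/d} (1 + q^{jd} + q^{2jd} + ⋯ + q^{(a−1)jd}) is divisible by [n]_{q^b} = 1 + q^b + q^{2b} + ⋯ + q^{(n−1)b} in the polynomial ring ℤ[q]. (Note that ∏_{j=1}^{n/d} (1 + q^{jd} + ⋯ + q^{(a−1)jd}) equals the quotient (q^{ad}; q^{ad})_{n/d} / (q^d; q^d)_{n/d}.) -/

import Mathlib

open Polynomial ArithmeticFunction Finset

/-- For a primitive `e`-th root of unity `ω` with `e` coprime to `a`, the product of the values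
`[a]` at `ω, ω², …, ω^e` is `a`. -/
lemma prod_geom_sum_period_of_coprime {K : Type*} [Field K] [CharZero K] {e a : ℕ} {ω : K}
    (hω : IsPrimitiveRoot ω e) (he : 0 < e) (h : e.Coprime a) :
    ∏ j ∈ range e, ∑ k ∈ range a, (ω ^ (j + 1)) ^ k = a := by
  obtain ⟨r, rfl⟩ : ∃ r, e = r + 1 := ⟨e - 1, by omega⟩
  rw [prod_range_succ, hω.pow_eq_one]
  have h1 := hω.prod_one_sub_pow_eq_order
  have h2 := (hω.pow_of_coprime a h.symm).prod_one_sub_pow_eq_order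
  have h3 : (∏ j ∈ range r, ∑ k ∈ range a, (ω ^ (j + 1)) ^ k) *
      ∏ j ∈ range r, (1 - ω ^ (j + 1)) = ∏ j ∈ range r, (1 - (ω ^ a) ^ (j + 1)) := by
    rw [← prod_mul_distrib]
    refine prod_congr rfl fun j _ => ?_
    rw [geom_sum_mul_neg, ← pow_mul, ← pow_mul, mul_comm]
  rw [h1, h2] at h3
  rw [(mul_eq_right₀ (Nat.cast_add_one_ne_zero r)).1 h3]
  simp

/-- The value of `∏_{j=1}^N [a]_{q^j}` at a primitive `e`-th root of unity with `e ∣ a * N`. -/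
lemma prod_geom_sum_primitiveRoot {K : Type*} [Field K] [CharZero K] {e a N : ℕ} {ω : K}
    (hω : IsPrimitiveRoot ω e) (he : 0 < e) (hN : 0 < N) (h : e ∣ a * N) :
    ∏ j ∈ Icc 1 N, ∑ k ∈ range a, (ω ^ j) ^ k =
      if e.Coprime a then (a : K) ^ (N / e) else 0 := by
  split_ifs with hc
  · obtain ⟨t, rfl⟩ := hc.dvd_of_dvd_mul_left h
    rw [Nat.mul_div_cancel_left _ he, ← Finset.Ico_add_one_right_eq_Icc, prod_Ico_eq_prod_range,
      Nat.add_sub_cancel]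
    clear h hN
    induction t with
    | zero => simp
    | succ t ih =>
      rw [mul_add, mul_one, prod_range_add, ih, pow_succ,
        ← prod_geom_sum_period_of_coprime hω he hc]
      congr 1
      refine prod_congr rfl fun j _ => sum_congr rfl fun k _ => ?_
      congr 1
      rw [show 1 + (e * t + j) = e * t + (j + 1) by ring, pow_add, pow_mul, hω.pow_eq_one,
        one_pow, one_mul]
  · have hg : 0 < e.gcd a := Nat.gcd_pos_of_pos_left _ he
    have hg1 : 1 < e.gcd a := lt_of_le_of_ne hg (Ne.symm hc)
    have hdvd : e / e.gcd a ∣ N := by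
      refine (Nat.coprime_div_gcd_div_gcd hg).dvd_of_dvd_mul_left ?_
      rw [← Nat.mul_dvd_mul_iff_left hg, ← mul_assoc, Nat.mul_div_cancel' (Nat.gcd_dvd_left _ _),
        Nat.mul_div_cancel' (Nat.gcd_dvd_right _ _)]
      exact h
    have hpos : 0 < e / e.gcd a := Nat.div_pos (Nat.gcd_le_left _ he) hg
    refine prod_eq_zero (mem_Icc.2 ⟨hpos, Nat.le_of_dvd hN hdvd⟩) ?_
    have hne : ω ^ (e / e.gcd a) ≠ 1 :=
      hω.pow_ne_one_of_pos_of_lt hpos.ne' (Nat.div_lt_self he hg1)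
    have hdiv : e ∣ e / e.gcd a * a := by
      rw [Nat.div_mul_right_comm (Nat.gcd_dvd_left _ _),
        Nat.mul_div_assoc _ (Nat.gcd_dvd_right _ _)]
      exact dvd_mul_right _ _
    have h0 := geom_sum_mul (ω ^ (e / e.gcd a)) a
    rw [← pow_mul ω, (hω.pow_eq_one_iff_dvd (e / e.gcd a * a)).2 hdiv, sub_self] at h0
    exact (mul_eq_zero.1 h0).resolve_right (sub_ne_zero.2 hne)

/-- A Möbius sum over the divisors of `n` vanishes if the summand ignores a prime factor of `n`. -/
lemma sum_divisors_moebius_mul_eq_zero {R : Type*} [CommRing R] {n p : ℕ} (hn : n ≠ 0)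
    (hp : p.Prime) (hpn : p ∣ n) (f : ℕ → R)
    (hf : ∀ d, d ∣ n → ¬ p ∣ d → f (p * d) = f d) :
    ∑ d ∈ n.divisors, (moebius d : R) * f d = 0 := by
  have key : ∀ d, d ∣ n → ¬ p ∣ d →
      (moebius d : R) * f d + (moebius (p * d) : R) * f (p * d) = 0 := by
    intro d hd hpd
    rw [hf d hd hpd, isMultiplicative_moebius.map_mul_of_coprime
      ((Nat.Prime.coprime_iff_not_dvd hp).2 hpd), moebius_apply_prime hp]
    push_cast
    ring
  have hsq : ∑ d ∈ n.divisors with Squarefree d, (moebius d : R) * f d =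
      ∑ d ∈ n.divisors, (moebius d : R) * f d := by
    refine sum_filter_of_ne fun d _ h => ?_
    by_contra hns
    simp [moebius_eq_zero_of_not_squarefree hns] at h
  have hsq_ndvd : ∀ d, Squarefree (p * d) → ¬ p ∣ d := fun d h hd =>
    hp.one_lt.ne' (Nat.isUnit_iff.1 (h p (Nat.mul_dvd_mul_left p hd)))
  rw [← hsq]
  refine sum_involution (fun d _ => if p ∣ d then d / p else p * d) ?_ ?_ ?_ ?_
  · intro d hd
    simp only [mem_filter, Nat.mem_divisors] at hd
    by_cases h : p ∣ d
    · obtain ⟨c, rfl⟩ := h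
      simp only [dvd_mul_right, if_true, Nat.mul_div_cancel_left _ hp.pos]
      rw [add_comm]
      exact key c ((dvd_mul_left _ _).trans hd.1.1) (hsq_ndvd c hd.2)
    · simp only [h, if_false]
      exact key d hd.1.1 h
  · intro d hd _
    simp only [mem_filter, Nat.mem_divisors] at hd
    by_cases h : p ∣ d
    · simp only [h, if_true]
      exact (Nat.div_lt_self (Nat.pos_of_dvd_of_pos hd.1.1 (Nat.pos_of_ne_zero hn)) hp.one_lt).ne
    · simp only [h, if_false]
      intro h'
      exact h (h' ▸ dvd_mul_right p d)
  · intro d hd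
    simp only [mem_filter, Nat.mem_divisors] at hd ⊢
    by_cases h : p ∣ d
    · simp only [h, if_true]
      have hdd : d / p ∣ d := Nat.div_dvd_of_dvd h
      exact ⟨⟨hdd.trans hd.1.1, hn⟩, hd.2.squarefree_of_dvd hdd⟩
    · simp only [h, if_false]
      have hc := (Nat.Prime.coprime_iff_not_dvd hp).2 h
      exact ⟨⟨hc.mul_dvd_of_dvd_of_dvd hpn hd.1.1, hn⟩,
        (Nat.squarefree_mul hc).2 ⟨hp.prime.squarefree, hd.2⟩⟩
  · intro d hd
    simp only [mem_filter, Nat.mem_divisors] at hd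
    by_cases h : p ∣ d
    · obtain ⟨c, rfl⟩ := h
      simp [Nat.mul_div_cancel_left _ hp.pos, hsq_ndvd c hd.2]
    · simp [h, Nat.mul_div_cancel_left _ hp.pos]

/-- If `p` occurs to a higher power in `m` than in `a`, then passing from `d` to `p * d`
with `p ∤ d` does not affect whether `m / gcd(m, d)` is coprime to `a`. -/
lemma coprime_div_gcd_prime_mul_iff {m a p d : ℕ} (hm : 0 < m) (ha : a ≠ 0) (hp : p.Prime)
    (hv : a.factorization p < m.factorization p) (hpd : ¬ p ∣ d) :
    (m / m.gcd (p * d)).Coprime a ↔ (m / m.gcd d).Coprime a := by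
  have hpm : p ∣ m := Nat.dvd_of_factorization_pos (by omega)
  have hc : p.Coprime d := (Nat.Prime.coprime_iff_not_dvd hp).2 hpd
  have hg : m.gcd (p * d) = p * m.gcd d := by
    rw [hc.gcd_mul, Nat.gcd_eq_right hpm]
  have hpe : p ∣ m / m.gcd d := by
    have h1 : p ∣ m.gcd d * (m / m.gcd d) := by
      rwa [Nat.mul_div_cancel' (Nat.gcd_dvd_left m d)]
    exact (Nat.Coprime.coprime_dvd_right (Nat.gcd_dvd_right m d) hc).dvd_of_dvd_mul_left h1
  rw [hg, mul_comm p, ← Nat.div_div_eq_div_mul]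
  have hme : m = m.gcd d * (m / m.gcd d) := (Nat.mul_div_cancel' (Nat.gcd_dvd_left m d)).symm
  obtain ⟨e, he⟩ := hpe
  rw [he, Nat.mul_div_cancel_left _ hp.pos, Nat.coprime_mul_iff_left]
  refine ⟨fun h => ⟨?_, h⟩, fun h => h.2⟩
  rw [Nat.Prime.coprime_iff_not_dvd hp]
  intro hpa
  have hva : 0 < a.factorization p := hp.factorization_pos_of_dvd ha hpa
  have hp2 : p ^ 2 ∣ m := (hp.pow_dvd_iff_le_factorization hm.ne').2 (by omega)
  rw [hme, he, ← mul_assoc, mul_comm _ p, mul_assoc, sq] at hp2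
  have h1 : p ∣ e := (Nat.Coprime.coprime_dvd_right (Nat.gcd_dvd_right m d) hc).dvd_of_dvd_mul_left
    (Nat.dvd_of_mul_dvd_mul_left hp.pos hp2)
  exact hp.one_lt.ne' (Nat.eq_one_of_dvd_coprimes h h1 hpa)

/-- The Möbius sum of products of `q`-integers vanishes at primitive `m`-th roots of unity for
`m ∣ n * gcd(n, a)` with `m ∤ gcd(n, a)`. -/
lemma sum_moebius_prod_geom_sum_primitiveRoot {K : Type*} [Field K] [CharZero K] {n a m : ℕ}
    (hn : 0 < n) (ha : 0 < a) {ζ : K} (hζ : IsPrimitiveRoot ζ m) (hm : m ∣ n * n.gcd a)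
    (hmb : ¬ m ∣ n.gcd a) :
    ∑ d ∈ n.divisors, (moebius d : K) *
      ∏ j ∈ Icc 1 (n / d), ∑ k ∈ range a, ζ ^ (k * j * d) = 0 := by
  have hm0 : 0 < m := Nat.pos_of_dvd_of_pos hm (Nat.mul_pos hn (Nat.gcd_pos_of_pos_left _ hn))
  have hdvd : ∀ d, d ∣ n → m / m.gcd d ∣ a * (n / d) := by
    intro d hd
    refine (Nat.coprime_div_gcd_div_gcd (Nat.gcd_pos_of_pos_left d hm0)).dvd_of_dvd_mul_left ?_
    rw [← Nat.mul_dvd_mul_iff_left (Nat.gcd_pos_of_pos_left d hm0), ← mul_assoc,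
      Nat.mul_div_cancel' (Nat.gcd_dvd_left _ _), Nat.mul_div_cancel' (Nat.gcd_dvd_right _ _),
      mul_left_comm, Nat.mul_div_cancel' hd, mul_comm]
    exact hm.trans (Nat.mul_dvd_mul_left n (Nat.gcd_dvd_right _ _))
  have hval : ∀ d ∈ n.divisors, (moebius d : K) *
      ∏ j ∈ Icc 1 (n / d), ∑ k ∈ range a, ζ ^ (k * j * d) =
      (moebius d : K) *
        (if (m / m.gcd d).Coprime a then (a : K) ^ (n / m.lcm d) else 0) := by
    intro d hd
    have hdn := Nat.dvd_of_mem_divisors hd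
    have hd0 : 0 < d := Nat.pos_of_dvd_of_pos hdn hn
    have hω : IsPrimitiveRoot (ζ ^ d) (m / m.gcd d) := by
      have := IsPrimitiveRoot.orderOf (ζ ^ d)
      rwa [orderOf_pow' ζ hd0.ne', ← hζ.eq_orderOf] at this
    have hl : m.lcm d = d * (m / m.gcd d) := by
      rw [Nat.lcm, mul_comm m d, Nat.mul_div_assoc _ (Nat.gcd_dvd_left _ _)]
    rw [hl, ← Nat.div_div_eq_div_mul, ← prod_geom_sum_primitiveRoot hω
      (Nat.div_pos (Nat.gcd_le_left _ hm0) (Nat.gcd_pos_of_pos_left d hm0))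
      (Nat.div_pos (Nat.le_of_dvd hn hdn) hd0) (hdvd d hdn)]
    congr 1
    refine prod_congr rfl fun j _ => sum_congr rfl fun k _ => ?_
    rw [← pow_mul, ← pow_mul]
    congr 1
    ring
  rw [sum_congr rfl hval]
  by_cases hmn : m ∣ n
  · have hma : ¬ m ∣ a := fun h => hmb (Nat.dvd_gcd hmn h)
    obtain ⟨p, hv⟩ : ∃ p, a.factorization p < m.factorization p := by
      by_contra! h
      exact hma ((Nat.factorization_le_iff_dvd hm0.ne' ha.ne').1 h)
    have hp : p.Prime := by
      by_contra h
      simp [Nat.factorization_eq_zero_of_not_prime m h] at hv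
    have hpm : p ∣ m := Nat.dvd_of_factorization_pos (by omega)
    refine sum_divisors_moebius_mul_eq_zero hn.ne' hp (hpm.trans hmn) _ fun d _ hpd => ?_
    have hl : m.lcm (p * d) = m.lcm d := by
      refine Nat.dvd_antisymm (Nat.lcm_dvd (Nat.dvd_lcm_left _ _) ?_)
        (Nat.lcm_dvd (Nat.dvd_lcm_left _ _)
          ((dvd_mul_left d p).trans (Nat.dvd_lcm_right _ _)))
      exact ((Nat.Prime.coprime_iff_not_dvd hp).2 hpd).mul_dvd_of_dvd_of_dvd
        (hpm.trans (Nat.dvd_lcm_left _ _)) (Nat.dvd_lcm_right _ _)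
    simp only [coprime_div_gcd_prime_mul_iff hm0 ha.ne' hp hv hpd, hl]
  · refine sum_eq_zero fun d hd => ?_
    have hdn := Nat.dvd_of_mem_divisors hd
    rw [if_neg, mul_zero]
    intro hc
    refine hmn ?_
    have h1 : d * (m / m.gcd d) ∣ n := by
      rw [← Nat.mul_div_cancel' hdn]
      exact Nat.mul_dvd_mul_left d (hc.dvd_of_dvd_mul_left (hdvd d hdn))
    refine Dvd.dvd.trans ?_ h1
    conv_lhs => rw [← Nat.mul_div_cancel' (Nat.gcd_dvd_left m d)]
    exact Nat.mul_dvd_mul_right (Nat.gcd_dvd_right _ _) _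

/-- The factorization of `1 + X^b + ⋯ + X^{(n-1)b}` into cyclotomic polynomials. -/
lemma sum_X_pow_mul_eq_prod_cyclotomic {n b : ℕ} (hn : 0 < n) (hb : 0 < b) :
    ∑ i ∈ range n, (X : ℤ[X]) ^ (i * b) =
      ∏ m ∈ (n * b).divisors \ b.divisors, cyclotomic m ℤ := by
  have h0 : (X ^ b - 1 : ℤ[X]) ≠ 0 := (monic_X_pow_sub_C 1 hb.ne').ne_zero
  refine mul_left_cancel₀ h0 ?_
  have hsub : b.divisors ⊆ (n * b).divisors :=
    Nat.divisors_subset_of_dvd (Nat.mul_pos hn hb).ne' (dvd_mul_left b n)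
  have h1 := prod_sdiff (f := fun m => cyclotomic m ℤ) hsub
  rw [prod_cyclotomic_eq_X_pow_sub_one hb, prod_cyclotomic_eq_X_pow_sub_one (Nat.mul_pos hn hb)]
    at h1
  rw [mul_comm _ (∏ m ∈ _, _), h1, mul_comm n b, pow_mul, ← mul_geom_sum (X ^ b : ℤ[X]) n]
  simp only [← pow_mul, mul_comm b]

/-- A product of distinct cyclotomic polynomials divides an integer polynomial that each of them
divides. -/
lemma prod_cyclotomic_dvd {s : Finset ℕ} {F : ℤ[X]} (h : ∀ m ∈ s, cyclotomic m ℤ ∣ F) :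
    ∏ m ∈ s, cyclotomic m ℤ ∣ F := by
  rw [← map_dvd_map (Int.castRingHom ℚ) Int.cast_injective
    (monic_prod_of_monic _ _ fun m _ => cyclotomic.monic m ℤ), Polynomial.map_prod]
  refine Finset.prod_dvd_of_coprime (fun i _ j _ hij => ?_) fun m hm =>
    Polynomial.map_dvd _ (h m hm)
  simpa only [Function.onFun, map_cyclotomic] using cyclotomic.isCoprime_rat hij

/-- q-analogue of Gauss' divisibility theorem:
`∑_{d∣n} μ(d) · ∏_{j=1}^{n/d} (1 + q^{jd} + ⋯ + q^{(a−1)jd})` is divisible by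
`[n]_{q^b} = 1 + q^b + ⋯ + q^{(n−1)b}` in `ℤ[q]`, where `b = gcd(n,a)`. -/
theorem q_gauss_divisibility (n a : ℕ) (hn : 0 < n) (ha : 0 < a) :
    (∑ i ∈ Finset.range n, (Polynomial.X : Polynomial ℤ) ^ (i * Nat.gcd n a)) ∣
      ∑ d ∈ n.divisors, Polynomial.C ((moebius d : ℤ)) *
        ∏ j ∈ Finset.Icc 1 (n / d),
          ∑ k ∈ Finset.range a, (Polynomial.X : Polynomial ℤ) ^ (k * j * d) := by
  rw [sum_X_pow_mul_eq_prod_cyclotomic hn (Nat.gcd_pos_of_pos_left a hn)]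
  refine prod_cyclotomic_dvd fun m hm => ?_
  simp only [mem_sdiff, Nat.mem_divisors, not_and, not_not] at hm
  have hmb : ¬ m ∣ n.gcd a := fun h => (Nat.gcd_pos_of_pos_left a hn).ne' (hm.2 h)
  have hm0 : 0 < m := Nat.pos_of_dvd_of_pos hm.1.1 (Nat.pos_of_ne_zero hm.1.2)
  have hζ := Complex.isPrimitiveRoot_exp m hm0.ne'
  rw [cyclotomic_eq_minpoly hζ hm0]
  refine minpoly.isIntegrallyClosed_dvd (hζ.isIntegral hm0) ?_
  simpa [map_sum, map_prod] using sum_moebius_prod_geom_sum_primitiveRoot hn ha hζ hm.1.1 hmb
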